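/- The stratum L_H^1 of points of SU(2)^g/SU(2) whose representatives have stabilizer a maximal torus is homeomorphic to (T^{g*})/W, the quotient of the non-central tuples in T^g by the order-2 Weyl group acting by simultaneous inversion-conjugation; in particular it is a smooth manifold of dimension g. -/

import Mathlib

noncomputable section
open Matrix
abbrev UG := Matrix.unitaryGroup (Fin 2) ℂ

/-- `SU(2)` as the subgroup of the `2 × 2` unitary group consisting of determinant-one
matrices. -/
def SU2 : Subgroup UG where
  carrier := {A | (A : Matrix (Fin 2) (Fin 2) ℂ).det = 1}
  mul_mem' := by
    intro a b ha hb
    simp only [Set.mem_setOf_eq] at *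
    rw [Matrix.UnitaryGroup.mul_val, Matrix.det_mul, ha, hb, one_mul]
  one_mem' := by simp
  inv_mem' := by
    intro a ha
    simp only [Set.mem_setOf_eq] at *
    rw [Matrix.UnitaryGroup.inv_val, Matrix.star_eq_conjTranspose, Matrix.det_conjTranspose, ha]
    simp

/-- The underlying matrix of an element of `SU(2)`. -/
def mval (g : SU2) : Matrix (Fin 2) (Fin 2) ℂ := g.1.1

/-- Membership in the center `{±I}` of `SU(2)`. -/
def IsCentral (g : SU2) : Prop := mval g = 1 ∨ mval g = -1

/-- The Lie algebra `su(2)`: traceless skew-adjoint `2 × 2` complex matrices, as a real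
submodule of the matrix space. -/
def su2 : Submodule ℝ (Matrix (Fin 2) (Fin 2) ℂ) where
  carrier := {X | Xᴴ = -X ∧ X.trace = 0}
  add_mem' := by
    rintro X Y ⟨h1, h2⟩ ⟨h3, h4⟩
    exact ⟨by rw [conjTranspose_add, h1, h3]; abel, by simp [h2, h4]⟩
  zero_mem' := by simp
  smul_mem' := by
    rintro r X ⟨h1, h2⟩
    exact ⟨by rw [conjTranspose_smul, h1]; simp, by simp [h2]⟩

/-- The adjoint action of `SU(2)` on matrices, `Ad g X = g X g⁻¹`. -/
def Ad (g : SU2) (X : Matrix (Fin 2) (Fin 2) ℂ) : Matrix (Fin 2) (Fin 2) ℂ :=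
  mval g * X * mval g⁻¹

/-- A maximal torus of `SU(2)`: a commutative, connected, closed subgroup that is maximal
among such subgroups. -/
def IsMaximalTorus (T : Subgroup SU2) : Prop :=
  (∀ a ∈ T, ∀ b ∈ T, a * b = b * a) ∧ IsConnected (T : Set SU2) ∧ IsClosed (T : Set SU2) ∧
    ∀ T' : Subgroup SU2,
      ((∀ a ∈ T', ∀ b ∈ T', a * b = b * a) ∧ IsConnected (T' : Set SU2) ∧
        IsClosed (T' : Set SU2)) → T ≤ T' → T' = T

/-- The setoid of simultaneous conjugation on `SU(2)^g`. -/
def conjSetoid (g : ℕ) : Setoid (Fin g → SU2) where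
  r x y := ∃ h : SU2, ∀ i, h * x i * h⁻¹ = y i
  iseqv := by
    constructor
    · exact fun x => ⟨1, fun i => by group⟩
    · rintro x y ⟨h, hh⟩
      exact ⟨h⁻¹, fun i => by rw [← hh i]; group⟩
    · rintro x y z ⟨h, hh⟩ ⟨k, hk⟩
      exact ⟨k * h, fun i => by rw [← hk i, ← hh i]; group⟩

/-- The setoid on the non-central tuples in `T^g` given by the order-2 Weyl group acting
by simultaneous inversion. -/
def weylSetoid (g : ℕ) (T : Subgroup SU2) :
    Setoid {t : Fin g → T // ∃ i, ¬ IsCentral (t i : SU2)} where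
  r t t' := t'.1 = t.1 ∨ t'.1 = fun i => (t.1 i)⁻¹
  iseqv := by
    constructor
    · exact fun t => Or.inl rfl
    · rintro t t' (h | h)
      · exact Or.inl h.symm
      · exact Or.inr (by rw [h]; funext i; simp)
    · rintro t t' t'' (h | h) (h' | h')
      · exact Or.inl (h'.trans h)
      · exact Or.inr (by rw [h', h])
      · exact Or.inr (by rw [h', h])
      · exact Or.inl (by rw [h', h]; funext i; simp)

/-- The stratum `L_H^1` of conjugation orbits whose stabilizer is conjugate to `T`. -/
def stratum1 (g : ℕ) (T : Subgroup SU2) : Type :=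
  {p : Quotient (conjSetoid g) // ∃ x : Fin g → SU2, Quotient.mk (conjSetoid g) x = p ∧
    ∃ h : SU2, {k : SU2 | ∀ i, k * x i * k⁻¹ = x i} =
      (fun a : SU2 => h * a * h⁻¹) '' (T : Set SU2)}

instance (g : ℕ) (T : Subgroup SU2) : TopologicalSpace (stratum1 g T) :=
  instTopologicalSpaceSubtype


open Topology

local notation "cj" => starRingEnd ℂ

theorem mval_injective : Function.Injective mval := fun _ _ h => Subtype.ext (Subtype.ext h)

theorem mval_mul (a b : SU2) : mval (a * b) = mval a * mval b := rfl

theorem mval_one : mval 1 = 1 := rfl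

theorem mval_inv (a : SU2) : mval a⁻¹ = (mval a)ᴴ := rfl

theorem continuous_mval : Continuous mval := continuous_subtype_val.comp continuous_subtype_val

theorem isEmbedding_mval : IsEmbedding mval :=
  IsEmbedding.subtypeVal.comp IsEmbedding.subtypeVal

theorem mval_mem (a : SU2) : mval a ∈ Matrix.unitaryGroup (Fin 2) ℂ := a.1.2

theorem mval_det (a : SU2) : (mval a).det = 1 := a.2

/-- Elements of `SU(2)` from their first row. -/
def mkSU (a b : ℂ) (h : a * cj a + b * cj b = 1) : SU2 :=
  ⟨⟨!![a, b; -cj b, cj a], by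
    rw [Matrix.mem_unitaryGroup_iff]
    ext i j
    fin_cases i <;> fin_cases j <;>
      simp [Matrix.mul_apply, Fin.sum_univ_two, Matrix.star_apply] <;>
      first | ring1 | linear_combination h⟩, by
    change Matrix.det !![a, b; -cj b, cj a] = 1
    rw [Matrix.det_fin_two_of]; linear_combination h⟩

theorem mval_mkSU (a b : ℂ) (h : a * cj a + b * cj b = 1) :
    mval (mkSU a b h) = !![a, b; -cj b, cj a] := rfl

theorem exists_mkSU (k : SU2) : ∃ a b h, k = mkSU a b h := by
  have h1 : mval k * star (mval k) = 1 := Matrix.mem_unitaryGroup_iff.1 (mval_mem k)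
  have hd := mval_det k
  have h2 : star (mval k) = (mval k).adjugate := by
    have h3 : (mval k).adjugate * mval k = 1 := by rw [Matrix.adjugate_mul, hd, one_smul]
    calc star (mval k) = ((mval k).adjugate * mval k) * star (mval k) := by rw [h3, one_mul]
      _ = _ := by rw [mul_assoc, h1, mul_one]
  rw [Matrix.adjugate_fin_two] at h2
  have e00 := congrFun (congrFun h2 0) 0
  have e01 := congrFun (congrFun h2 1) 0
  simp [Matrix.star_apply] at e00 e01
  rw [Matrix.det_fin_two] at hd
  refine ⟨mval k 0 0, mval k 0 1, ?_, ?_⟩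
  · rw [e00, e01]; linear_combination hd
  · apply mval_injective
    rw [mval_mkSU]
    ext i j
    fin_cases i <;> fin_cases j <;> simp [e00, e01]

instance compactSU2 : CompactSpace SU2 := by
  rw [← isCompact_univ_iff, isEmbedding_mval.isCompact_iff, Set.image_univ]
  have hr : Set.range mval = {M | M * star M = 1 ∧ M.det = 1} := by
    ext M
    constructor
    · rintro ⟨k, rfl⟩
      exact ⟨Matrix.mem_unitaryGroup_iff.1 (mval_mem k), mval_det k⟩
    · rintro ⟨h1, h2⟩
      exact ⟨⟨⟨M, Matrix.mem_unitaryGroup_iff.2 h1⟩, h2⟩, rfl⟩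
  have hc : IsClosed (Set.range mval) := by
    rw [hr]
    apply IsClosed.and
    · exact isClosed_eq (by fun_prop) continuous_const
    · exact isClosed_eq (by fun_prop) continuous_const
  have hK : IsCompact (Set.pi Set.univ fun _ : Fin 2 => Set.pi Set.univ
      fun _ : Fin 2 => Metric.closedBall (0 : ℂ) 1) :=
    isCompact_univ_pi fun _ => isCompact_univ_pi fun _ => isCompact_closedBall _ _
  refine hK.of_isClosed_subset hc ?_
  rintro _ ⟨k, rfl⟩ i _ j _
  simpa using entry_norm_bound_of_unitary (mval_mem k) i j

instance t2SU2 : T2Space SU2 := inferInstance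
instance topGrpSU2 : IsTopologicalGroup SU2 := inferInstance

theorem circle_mul_conj (z : Circle) : (z : ℂ) * cj (z : ℂ) = 1 := by
  rw [Complex.mul_conj, Circle.normSq_coe]; simp

theorem exists_circle (a : ℂ) (h : ‖a‖ = 1) : ∃ z : Circle, (z : ℂ) = a :=
  ⟨⟨a, mem_sphere_zero_iff_norm.2 h⟩, rfl⟩

/-- The diagonal torus. -/
def dg : Circle →* SU2 where
  toFun z := mkSU z 0 (by simp [circle_mul_conj])
  map_one' := by
    apply mval_injective
    rw [mval_mkSU, mval_one]
    ext i j
    fin_cases i <;> fin_cases j <;> simp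
  map_mul' z w := by
    apply mval_injective
    rw [mval_mul, mval_mkSU, mval_mkSU, mval_mkSU]
    ext i j
    fin_cases i <;> fin_cases j <;> simp [Matrix.mul_apply, Fin.sum_univ_two]

theorem mval_dg (z : Circle) : mval (dg z) = !![(z : ℂ), 0; 0, cj (z : ℂ)] := by
  have : mval (dg z) = !![(z : ℂ), 0; -cj 0, cj (z : ℂ)] := rfl
  rw [this]; simp

theorem continuous_dg : Continuous dg := by
  rw [isEmbedding_mval.continuous_iff]
  refine continuous_matrix fun i j => ?_
  simp only [Function.comp_apply, mval_dg]
  fin_cases i <;> fin_cases j <;> simp <;> fun_prop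

theorem dg_injective : Function.Injective dg := by
  intro z w h
  have := congrFun (congrFun (congrArg mval h) 0) 0
  rw [mval_dg, mval_dg] at this
  exact Circle.ext (by simpa using this)

theorem dg_central (z : Circle) : IsCentral (dg z) ↔ z = z⁻¹ := by
  have h1 : z = z⁻¹ ↔ (z : ℂ) = 1 ∨ (z : ℂ) = -1 := by
    rw [eq_inv_iff_mul_eq_one, Circle.ext_iff, Circle.coe_mul, Circle.coe_one, mul_self_eq_one_iff]
  rw [h1, IsCentral, mval_dg]
  constructor
  · rintro (h | h)
    · left; simpa using congrFun (congrFun h 0) 0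
    · right; simpa using congrFun (congrFun h 0) 0
  · rintro (h | h)
    · left; rw [h]; ext i j; fin_cases i <;> fin_cases j <;> simp
    · right; rw [h]; ext i j; fin_cases i <;> fin_cases j <;> simp

theorem IsCentral.comm {x : SU2} (h : IsCentral x) (k : SU2) : k * x = x * k := by
  apply mval_injective
  rw [mval_mul, mval_mul]
  rcases h with h | h <;> rw [h] <;> simp

theorem dg_centralizer (z : Circle) (hz : z ≠ z⁻¹) (k : SU2) (h : k * dg z = dg z * k) :
    ∃ w, k = dg w := by
  obtain ⟨a, b, hab, rfl⟩ := exists_mkSU k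
  have e := congrFun (congrFun (congrArg mval h) 0) 1
  rw [mval_mul, mval_mul, mval_mkSU, mval_dg] at e
  simp [Matrix.mul_apply, Fin.sum_univ_two] at e
  have hb : b = 0 := by
    by_contra hb
    apply hz
    apply Circle.ext
    rw [Circle.coe_inv_eq_conj]
    apply mul_left_cancel₀ hb
    linear_combination -e
  subst hb
  have ha : ‖a‖ = 1 := by
    have : a * cj a = 1 := by simpa using hab
    rw [Complex.mul_conj, Complex.normSq_eq_norm_sq] at this
    have h2 : ‖a‖ ^ 2 = 1 := by exact_mod_cast this
    nlinarith [norm_nonneg a]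
  obtain ⟨w, rfl⟩ := exists_circle a ha
  refine ⟨w, ?_⟩
  apply mval_injective
  rw [mval_dg, mval_mkSU]
  simp

theorem dg_weyl : ∃ w : SU2, ∀ z, w * dg z * w⁻¹ = dg z⁻¹ := by
  refine ⟨mkSU 0 1 (by simp), fun z => ?_⟩
  rw [mul_inv_eq_iff_eq_mul]
  apply mval_injective
  rw [mval_mul, mval_mul, mval_dg, mval_dg, mval_mkSU]
  ext i j
  fin_cases i <;> fin_cases j <;>
    simp [Matrix.mul_apply, Fin.sum_univ_two, ← Circle.coe_inv_eq_conj]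

theorem dg_trace (z w : Circle) (k : SU2) (h : k * dg z * k⁻¹ = dg w) : w = z ∨ w = z⁻¹ := by
  have ht : (mval (dg z)).trace = (mval (dg w)).trace := by
    rw [← h, mval_mul, mval_mul, Matrix.trace_mul_comm, ← mul_assoc, ← mval_mul]
    simp [mval_one]
  rw [mval_dg, mval_dg, Matrix.trace_fin_two_of, Matrix.trace_fin_two_of] at ht
  have hz := circle_mul_conj z
  have hw := circle_mul_conj w
  have h3 : ((w : ℂ) - z) * (w - cj (z : ℂ)) = 0 := by
    linear_combination hz - hw - (w : ℂ) * ht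
  rcases mul_eq_zero.1 h3 with h | h
  · left; exact Circle.ext (sub_eq_zero.1 h)
  · right; apply Circle.ext; rw [Circle.coe_inv_eq_conj]; exact sub_eq_zero.1 h

theorem dg_all_conj (k : SU2) : ∃ (h : SU2) (z : Circle), k = h * dg z * h⁻¹ := by
  obtain ⟨a, b, hab, rfl⟩ := exists_mkSU k
  by_cases hb : b = 0
  · obtain ⟨w, hw⟩ := dg_centralizer (Circle.exp (Real.pi / 2)) (by
      rw [Ne, eq_inv_iff_mul_eq_one, ← Circle.exp_add, add_halves, Circle.ext_iff, Circle.coe_exp,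
        Complex.exp_pi_mul_I]
      intro h
      have := congrArg Complex.re h
      norm_num at this) (mkSU a b hab) (by
      subst hb
      apply mval_injective
      rw [mval_mul, mval_mul, mval_mkSU, mval_dg]
      ext i j
      fin_cases i <;> fin_cases j <;> simp [Matrix.mul_apply, Fin.sum_univ_two, mul_comm])
    exact ⟨1, w, by simp [hw]⟩
  · obtain ⟨r, s⟩ := a
    set β : ℝ := Complex.normSq b with hβ
    have hβ0 : 0 < β := Complex.normSq_pos.2 hb
    have hbb : b * cj b = (β : ℂ) := Complex.mul_conj b
    have hr : r ^ 2 + s ^ 2 + β = 1 := by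
      rw [Complex.mul_conj, Complex.mul_conj, Complex.normSq_mk] at hab
      have : r * r + s * s + β = 1 := by exact_mod_cast hab
      linarith
    set l : ℝ := Real.sqrt (s ^ 2 + β) with hl
    have hl2 : l ^ 2 = s ^ 2 + β := Real.sq_sqrt (by positivity)
    set N : ℝ := Real.sqrt (β + (l - s) ^ 2) with hN
    have hN2 : N ^ 2 = β + (l - s) ^ 2 := Real.sq_sqrt (by positivity)
    have hN0 : N ≠ 0 := (Real.sqrt_pos.2 (by positivity)).ne'
    have hN0' : (N : ℂ) ≠ 0 := by exact_mod_cast hN0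
    have hN2' : (N : ℂ) ^ 2 = β + (l - s) ^ 2 := by exact_mod_cast hN2
    have hl2' : (l : ℂ) ^ 2 = s ^ 2 + β := by exact_mod_cast hl2
    have ha : (⟨r, s⟩ : ℂ) = r + s * Complex.I := Complex.mk_eq_add_mul_I r s
    have hz : ‖(r + l * Complex.I : ℂ)‖ = 1 := by
      rw [← Complex.mk_eq_add_mul_I, Complex.norm_def, Complex.normSq_mk]
      rw [show r * r + l * l = 1 by nlinarith]; simp
    have hP : (b / N) * cj (b / N) + (Complex.I * (l - s) / N) * cj (Complex.I * (l - s) / N)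
        = 1 := by
      simp only [map_div₀, map_mul, map_sub, Complex.conj_ofReal, Complex.conj_I]
      field_simp
      linear_combination hbb - hN2' - (l - s : ℂ) ^ 2 * Complex.I_sq
    obtain ⟨w, hw⟩ := exists_circle _ hz
    refine ⟨mkSU _ _ hP, w, ?_⟩
    rw [eq_mul_inv_iff_mul_eq]
    apply mval_injective
    rw [mval_mul, mval_mul, mval_mkSU, mval_mkSU, mval_dg]
    simp only [ha, hw]
    ext i j
    fin_cases i <;> fin_cases j <;>
      simp [Matrix.mul_apply, Fin.sum_univ_two] <;> field_simp
    · ring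
    · linear_combination hbb - hl2' + (s * (l - s) + l * (l-s) : ℂ) * Complex.I_sq
    · linear_combination -hbb + hl2' - (s * (l - s) + l * (l-s) : ℂ) * Complex.I_sq
    · ring

theorem noncomm : ∃ a b : SU2, a * b ≠ b * a := by
  refine ⟨mkSU 0 1 (by simp), mkSU Complex.I 0 (by simp), fun h => ?_⟩
  have e := congrFun (congrFun (congrArg mval h) 0) 1
  rw [mval_mul, mval_mul, mval_mkSU, mval_mkSU] at e
  simp [Matrix.mul_apply, Fin.sum_univ_two] at e
  have := congrArg Complex.im e
  norm_num at this

/-- A parametrization of a maximal torus by the circle with the facts we need. -/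
structure TorusParam (T : Subgroup SU2) where
  c : Circle →* SU2
  cont : Continuous c
  inj : Function.Injective c
  mem : ∀ x, x ∈ T ↔ ∃ z, x = c z
  central : ∀ z, IsCentral (c z) ↔ z = z⁻¹
  centralizer : ∀ z, z ≠ z⁻¹ → ∀ k, k * c z = c z * k → k ∈ T
  weyl : ∃ w : SU2, ∀ z, w * c z * w⁻¹ = c z⁻¹
  trace : ∀ z w k, k * c z * k⁻¹ = c w → w = z ∨ w = z⁻¹

theorem IsCentral.conj {x : SU2} (h : IsCentral x) (k : SU2) : IsCentral (k * x * k⁻¹) := by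
  rwa [h.comm, mul_inv_cancel_right]

theorem isCentral_conj {x : SU2} (k : SU2) : IsCentral (k * x * k⁻¹) ↔ IsCentral x := by
  refine ⟨fun h => ?_, fun h => h.conj k⟩
  have := h.conj k⁻¹
  simpa [mul_assoc] using this

/-- The conjugated diagonal torus. -/
def cdg (h : SU2) : Circle →* SU2 := (MulAut.conj h).toMonoidHom.comp dg

theorem cdg_apply (h : SU2) (z : Circle) : cdg h z = h * dg z * h⁻¹ := rfl

theorem continuous_cdg (h : SU2) : Continuous (cdg h) := by
  have : (cdg h : Circle → SU2) = fun z => h * dg z * h⁻¹ := rfl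
  rw [this]
  have := continuous_dg
  fun_prop

def cdgParam (h : SU2) : TorusParam (cdg h).range where
  c := cdg h
  cont := continuous_cdg h
  inj := by
    intro z w e
    rw [cdg_apply, cdg_apply] at e
    exact dg_injective (by simpa using e)
  mem x := by simp [eq_comm]
  central z := by rw [cdg_apply, isCentral_conj, dg_central]
  centralizer z hz k hk := by
    rw [cdg_apply] at hk
    obtain ⟨w, hw⟩ := dg_centralizer z hz (h⁻¹ * k * h) (by
      calc h⁻¹ * k * h * dg z = h⁻¹ * (k * (h * dg z * h⁻¹)) * h := by group
        _ = _ := by rw [hk]; group)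
    exact ⟨w, by rw [cdg_apply, ← hw]; group⟩
  weyl := by
    obtain ⟨w, hw⟩ := dg_weyl
    refine ⟨h * w * h⁻¹, fun z => ?_⟩
    rw [cdg_apply, cdg_apply, ← hw]; group
  trace z w k hk := by
    rw [cdg_apply, cdg_apply] at hk
    refine dg_trace z w (h⁻¹ * k * h) ?_
    calc h⁻¹ * k * h * dg z * (h⁻¹ * k * h)⁻¹ = h⁻¹ * (k * (h * dg z * h⁻¹) * k⁻¹) * h := by group
      _ = _ := by rw [hk]; group

theorem cdg_torus (h : SU2) : (∀ a ∈ (cdg h).range, ∀ b ∈ (cdg h).range, a * b = b * a) ∧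
    IsConnected ((cdg h).range : Set SU2) ∧ IsClosed ((cdg h).range : Set SU2) := by
  refine ⟨?_, ?_, ?_⟩
  · rintro _ ⟨z, rfl⟩ _ ⟨w, rfl⟩
    rw [← map_mul, ← map_mul, mul_comm]
  · rw [MonoidHom.coe_range]
    exact isConnected_range (continuous_cdg h)
  · rw [MonoidHom.coe_range]
    exact (isCompact_range (continuous_cdg h)).isClosed

theorem exists_param {T : Subgroup SU2} (hT : IsMaximalTorus T) : Nonempty (TorusParam T) := by
  obtain ⟨hc, -, -, hmax⟩ := hT
  suffices H : ∃ h, T ≤ (cdg h).range by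
    obtain ⟨h, hh⟩ := H
    rw [← hmax _ (cdg_torus h) hh]
    exact ⟨cdgParam h⟩
  by_cases H : ∀ t ∈ T, IsCentral t
  · refine ⟨1, fun t ht => ?_⟩
    obtain ⟨h, z, hz⟩ := dg_all_conj t
    refine ⟨z, ?_⟩
    have h1 : IsCentral (dg z) := by
      rw [← isCentral_conj h, ← hz]; exact H t ht
    rw [hz, h1.comm, cdg_apply]; simp
  · push Not at H
    obtain ⟨t, ht, hnc⟩ := H
    obtain ⟨h, z, hz⟩ := dg_all_conj t
    refine ⟨h, fun s hs => ?_⟩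
    have hz' : t = (cdgParam h).c z := hz
    refine (cdgParam h).centralizer z ?_ s ?_
    · rwa [Ne, ← (cdgParam h).central, ← hz']
    · rw [← hz']; exact hc s hs t ht

namespace TorusParam
variable {T : Subgroup SU2}

theorem comm (P : TorusParam T) {a b : SU2} (ha : a ∈ T) (hb : b ∈ T) : a * b = b * a := by
  obtain ⟨z, rfl⟩ := (P.mem _).1 ha
  obtain ⟨w, rfl⟩ := (P.mem _).1 hb
  rw [← map_mul, ← map_mul, mul_comm]

theorem mem_of_comm (P : TorusParam T) {t k : SU2} (ht : t ∈ T) (hn : ¬ IsCentral t) (h : k * t = t * k) : k ∈ T := by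
  obtain ⟨z, rfl⟩ := (P.mem _).1 ht
  exact P.centralizer z (by rwa [Ne, ← P.central]) k h

theorem exists_noncentral (P : TorusParam T) : ∃ t ∈ T, ¬ IsCentral t := by
  refine ⟨P.c (Circle.exp (Real.pi / 2)), (P.mem _).2 ⟨_, rfl⟩, ?_⟩
  rw [P.central, eq_inv_iff_mul_eq_one, ← Circle.exp_add, add_halves, Circle.ext_iff,
    Circle.coe_exp, Complex.exp_pi_mul_I]
  intro h
  have := congrArg Complex.re h
  norm_num at this

theorem weyl' (P : TorusParam T) : ∃ w : SU2, ∀ t ∈ T, w * t * w⁻¹ = t⁻¹ := by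
  obtain ⟨w, hw⟩ := P.weyl
  refine ⟨w, fun t ht => ?_⟩
  obtain ⟨z, rfl⟩ := (P.mem _).1 ht
  rw [hw, map_inv]

theorem trace' (P : TorusParam T) {t s k : SU2} (ht : t ∈ T) (hs : s ∈ T) (h : k * t * k⁻¹ = s) : s = t ∨ s = t⁻¹ := by
  obtain ⟨z, rfl⟩ := (P.mem _).1 ht
  obtain ⟨w, rfl⟩ := (P.mem _).1 hs
  rcases P.trace z w k h with h | h
  · left; rw [h]
  · right; rw [h, map_inv]

theorem isClosed (P : TorusParam T) : IsClosed (T : Set SU2) := by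
  have : (T : Set SU2) = Set.range P.c := by
    ext x; simp [P.mem, eq_comm]
  rw [this]
  exact (isCompact_range P.cont).isClosed

/-- injectivity modulo the Weyl group -/
theorem conj_tuple (P : TorusParam T) {g : ℕ} {t s : Fin g → T} (hn : ∃ i, ¬ IsCentral (t i : SU2)) {k : SU2}
    (h : ∀ i, k * t i * k⁻¹ = s i) : s = t ∨ s = fun i => (t i)⁻¹ := by
  obtain ⟨i, hi⟩ := hn
  obtain ⟨w, hw⟩ := P.weyl'
  rcases P.trace' (t i).2 (s i).2 (h i) with h1 | h1
  · left
    have hk : k ∈ T := P.mem_of_comm (t i).2 hi 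
      (mul_inv_eq_iff_eq_mul.1 ((h i).trans h1))
    funext j
    apply Subtype.ext
    rw [← h j, P.comm hk (t j).2, mul_inv_cancel_right]
  · right
    have h2 : k * t i * k⁻¹ = w * t i * w⁻¹ := by rw [h, h1, hw _ (t i).2]
    have hk : w⁻¹ * k ∈ T := by
      refine P.mem_of_comm (t i).2 hi ?_
      calc w⁻¹ * k * t i = w⁻¹ * (k * t i * k⁻¹) * k := by group
        _ = _ := by rw [h2]; group
    funext j
    apply Subtype.ext
    have h3 := P.comm hk (t j).2
    calc (s j : SU2) = w * (w⁻¹ * k * t j) * k⁻¹ := by rw [← h j]; group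
      _ = w * t j * w⁻¹ := by rw [h3]; group
      _ = _ := by rw [hw _ (t j).2]; rfl

theorem stab_iff (P : TorusParam T) {g : ℕ} (t : Fin g → T) :
    (∃ x : Fin g → SU2, Quotient.mk (conjSetoid g) x =
      Quotient.mk (conjSetoid g) (fun i => (t i : SU2)) ∧
    ∃ h : SU2, {k : SU2 | ∀ i, k * x i * k⁻¹ = x i} =
      (fun a : SU2 => h * a * h⁻¹) '' (T : Set SU2)) ↔ ∃ i, ¬ IsCentral (t i : SU2) := by
  constructor
  · rintro ⟨x, hx, h, hh⟩
    obtain ⟨k, hk⟩ : ∃ k : SU2, ∀ i, k * x i * k⁻¹ = t i := Quotient.exact hx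
    by_contra! hc
    have hx : ∀ i, IsCentral (x i) := fun i => by
      rw [← isCentral_conj k, hk]; exact hc i
    have hT : ∀ a : SU2, a ∈ T := by
      intro a
      have : h * a * h⁻¹ ∈ {k : SU2 | ∀ i, k * x i * k⁻¹ = x i} := fun i => by
        rw [(hx i).comm, mul_inv_cancel_right]
      rw [hh] at this
      obtain ⟨b, hb, e⟩ := this
      have : b = a := by simpa using e
      exact this ▸ hb
    obtain ⟨a, b, hab⟩ := noncomm
    exact hab (P.comm (hT a) (hT b))
  · rintro ⟨i, hi⟩
    refine ⟨_, rfl, 1, ?_⟩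
    ext k
    constructor
    · intro hk
      refine ⟨k, P.mem_of_comm (t i).2 hi ?_, by simp⟩
      exact mul_inv_eq_iff_eq_mul.1 (hk i)
    · rintro ⟨a, ha, rfl⟩ j
      simp only [one_mul, inv_one, mul_one]
      rw [P.comm ha (t j).2, mul_inv_cancel_right]

theorem stab_surj (P : TorusParam T) {g : ℕ} (p : Quotient (conjSetoid g))
    (hp : ∃ x : Fin g → SU2, Quotient.mk (conjSetoid g) x = p ∧
    ∃ h : SU2, {k : SU2 | ∀ i, k * x i * k⁻¹ = x i} =
      (fun a : SU2 => h * a * h⁻¹) '' (T : Set SU2)) :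
    ∃ t : Fin g → T, Quotient.mk (conjSetoid g) (fun i => (t i : SU2)) = p := by
  obtain ⟨x, rfl, h, hh⟩ := hp
  obtain ⟨t, ht, hn⟩ := P.exists_noncentral
  have hm : ∀ i, h⁻¹ * x i * h ∈ T := by
    intro i
    refine P.mem_of_comm ht hn ?_
    have : h * t * h⁻¹ ∈ {k : SU2 | ∀ i, k * x i * k⁻¹ = x i} := by
      rw [hh]; exact ⟨t, ht, rfl⟩
    have := mul_inv_eq_iff_eq_mul.1 (this i)
    calc h⁻¹ * x i * h * t = h⁻¹ * (x i * (h * t * h⁻¹)) * h := by group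
      _ = _ := by rw [← this]; group
  refine ⟨fun i => ⟨_, hm i⟩, Quotient.sound ⟨h, fun i => ?_⟩⟩
  group

end TorusParam

theorem charted_of_localHomeo {H Y : Type*} [TopologicalSpace H] [TopologicalSpace Y]
    (U : TopologicalSpace.Opens H) (G : U → Y) (hG : IsLocalHomeomorph G)
    (hs : Function.Surjective G) : Nonempty (ChartedSpace H Y) := by
  choose x hx using hs
  choose e he1 he2 using hG
  refine ⟨{ atlas := Set.range fun y => (e (x y)).symm.trans (chartAt H (x y))
            chartAt := fun y => (e (x y)).symm.trans (chartAt H (x y))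
            mem_chart_source := fun y => ?_
            chart_mem_atlas := fun y => ⟨y, rfl⟩ }⟩
  have h1 : e (x y) (x y) = y := by rw [← he2, hx]
  have h2 := (e (x y)).map_source (he1 (x y))
  have h3 := (e (x y)).left_inv (he1 (x y))
  rw [h1] at h2 h3
  rw [OpenPartialHomeomorph.trans_source]
  refine ⟨h2, ?_⟩
  rw [Set.mem_preimage, h3]
  exact mem_chart_source H (x y)

theorem localHomeo_of_open_locInj {X Y : Type*} [TopologicalSpace X] [TopologicalSpace Y]
    {f : X → Y} (hc : Continuous f) (ho : IsOpenMap f)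
    (hi : ∀ x, ∃ N ∈ 𝓝 x, Set.InjOn f N) : IsLocalHomeomorph f := by
  rw [isLocalHomeomorph_iff_isOpenEmbedding_restrict]
  intro x
  obtain ⟨N, hN, hinj⟩ := hi x
  refine ⟨interior N, interior_mem_nhds.2 hN, ?_⟩
  refine Topology.IsOpenEmbedding.of_continuous_injective_isOpenMap ?_ ?_ ?_
  · exact hc.comp continuous_subtype_val
  · exact (hinj.mono interior_subset).injective
  · exact ho.comp isOpen_interior.isOpenMap_subtype_val

namespace TorusParam
variable {T : Subgroup SU2}

/-- The map from tuples in the torus to the conjugation quotient. -/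
def toQ (g : ℕ) (T : Subgroup SU2) (t : Fin g → T) : Quotient (conjSetoid g) :=
  Quotient.mk (conjSetoid g) (fun i => (t i : SU2))

theorem continuous_toQ (g : ℕ) : Continuous (toQ g T) :=
  continuous_quotient_mk'.comp (by fun_prop)

theorem isClosedMap_toQ (P : TorusParam T) (g : ℕ) : IsClosedMap (toQ g T) := by
  have : CompactSpace T := isCompact_iff_compactSpace.1 P.isClosed.isCompact
  intro C hC
  rw [← isQuotientMap_quotient_mk'.isClosed_preimage]
  have : (Quotient.mk (conjSetoid g)) ⁻¹' (toQ g T '' C) =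
      (fun p : SU2 × (Fin g → T) => fun i => p.1 * (p.2 i : SU2) * p.1⁻¹) '' (Set.univ ×ˢ C) := by
    ext x
    constructor
    · rintro ⟨t, ht, e⟩
      obtain ⟨k, hk⟩ : ∃ k : SU2, ∀ i, k * t i * k⁻¹ = x i := Quotient.exact e
      exact ⟨(k, t), ⟨trivial, ht⟩, funext hk⟩
    · rintro ⟨⟨k, t⟩, ⟨-, ht⟩, rfl⟩
      exact ⟨t, ht, Quotient.sound ⟨k, fun i => rfl⟩⟩
  refine Eq.subst (motive := IsClosed) this.symm ?_
  exact ((isCompact_univ.prod hC.isCompact).image (by fun_prop)).isClosed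

theorem homeo (P : TorusParam T) (g : ℕ) : Nonempty (Quotient (weylSetoid g T) ≃ₜ stratum1 g T) := by
  let S : Set (Quotient (conjSetoid g)) :=
    {p | ∃ x : Fin g → SU2, Quotient.mk (conjSetoid g) x = p ∧
    ∃ h : SU2, {k : SU2 | ∀ i, k * x i * k⁻¹ = x i} =
      (fun a : SU2 => h * a * h⁻¹) '' (T : Set SU2)}
  have hS : ∀ t : Fin g → T, toQ g T t ∈ S ↔ ∃ i, ¬ IsCentral (t i : SU2) := P.stab_iff
  let f : {t : Fin g → T // ∃ i, ¬ IsCentral (t i : SU2)} → S :=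
    fun t => ⟨toQ g T t.1, (hS _).2 t.2⟩
  have hfc : Continuous f :=
    ((continuous_toQ g).comp continuous_subtype_val).subtype_mk _
  have hfs : Function.Surjective f := by
    rintro ⟨p, hp⟩
    obtain ⟨t, rfl⟩ := P.stab_surj p hp
    exact ⟨⟨t, (hS t).1 hp⟩, rfl⟩
  have hfcl : IsClosedMap f := by
    have h1 := (P.isClosedMap_toQ g).restrictPreimage S
    have h2 : {t : Fin g → T | ∃ i, ¬ IsCentral (t i : SU2)} = toQ g T ⁻¹' S := by
      ext t; exact (hS t).symm
    exact h1.comp (Homeomorph.setCongr h2).isClosedMap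
  have hq : IsQuotientMap f := hfcl.isQuotientMap hfc hfs
  have hker : ∀ t s, weylSetoid g T t s ↔ Setoid.ker f t s := by
    intro t s
    rw [Setoid.ker_def]
    constructor
    · intro h
      apply Subtype.ext
      rcases h with h | h
      · exact congrArg (toQ g T) h.symm
      · obtain ⟨w, hw⟩ := P.weyl'
        refine Quotient.sound ⟨w, fun i => ?_⟩
        rw [h]
        exact hw _ (t.1 i).2
    · intro h
      have h' : toQ g T t.1 = toQ g T s.1 := congrArg Subtype.val h
      obtain ⟨k, hk⟩ : ∃ k : SU2, ∀ i, k * t.1 i * k⁻¹ = s.1 i := Quotient.exact h'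
      exact P.conj_tuple t.2 hk
  have hke : weylSetoid g T = Setoid.ker f := Setoid.ext hker
  rw [hke]
  exact ⟨IsQuotientMap.homeomorph (f := ⟨f, hfc⟩) hq⟩

theorem exists_circle_homeo (P : TorusParam T) : ∃ e : Circle ≃ₜ T, ∀ z, (e z : SU2) = P.c z := by
  let f : Circle → T := fun z => ⟨P.c z, (P.mem _).2 ⟨z, rfl⟩⟩
  have hf : Continuous f := P.cont.subtype_mk _
  have hb : Function.Bijective f := by
    constructor
    · intro z w h
      exact P.inj (congrArg Subtype.val h)
    · rintro ⟨x, hx⟩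
      obtain ⟨z, rfl⟩ := (P.mem _).1 hx
      exact ⟨z, rfl⟩
  exact ⟨hf.homeoOfEquivCompactToT2 (f := Equiv.ofBijective f hb), fun z => rfl⟩

theorem isOpenMap_weyl (g : ℕ) : IsOpenMap (Quotient.mk (weylSetoid g T)) := by
  intro V hV
  rw [← isQuotientMap_quotient_mk'.isOpen_preimage]
  let ι : {t : Fin g → T // ∃ i, ¬ IsCentral (t i : SU2)} →
      {t : Fin g → T // ∃ i, ¬ IsCentral (t i : SU2)} :=
    fun t => ⟨fun i => (t.1 i)⁻¹, by
      obtain ⟨i, hi⟩ := t.2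
      refine ⟨i, fun h => hi ?_⟩
      rcases h with h | h
      · left
        have := congrArg Matrix.conjTranspose h
        simpa [mval_inv] using this
      · right
        have := congrArg Matrix.conjTranspose h
        simpa [mval_inv] using this⟩
  have hι : Continuous ι := by
    refine Continuous.subtype_mk ?_ _
    exact continuous_pi fun i => ((continuous_apply i).comp continuous_subtype_val).inv
  have : (Quotient.mk (weylSetoid g T)) ⁻¹' (Quotient.mk (weylSetoid g T) '' V) = V ∪ ι ⁻¹' V := by
    ext t
    constructor
    · rintro ⟨s, hs, e⟩
      have e' : weylSetoid g T t s := Quotient.exact e.symm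
      rcases e' with h | h
      · left; rwa [← Subtype.ext h]
      · right
        have : s = ι t := Subtype.ext h
        rwa [this] at hs
    · rintro (h | h)
      · exact ⟨t, h, rfl⟩
      · exact ⟨ι t, h, (Quotient.sound (Or.inr rfl)).symm⟩
  refine Eq.subst (motive := IsOpen) this.symm ?_
  exact hV.union (hV.preimage hι)

theorem exists_cover (P : TorusParam T) (g : ℕ) : ∃ (U : TopologicalSpace.Opens (EuclideanSpace ℝ (Fin g)))
    (G : U → Quotient (weylSetoid g T)), IsLocalHomeomorph G ∧ Function.Surjective G := by
  obtain ⟨e, he⟩ := P.exists_circle_homeo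
  let E₀ : (Fin g → ℝ) → (Fin g → T) := Pi.map fun _ => e ∘ Circle.exp
  have hE₀o : IsOpenMap E₀ := IsOpenMap.piMap
    (fun _ => e.isOpenMap.comp isLocalHomeomorph_circleExp.isOpenMap)
    (by simp [e.surjective.comp Circle.exp_surjective])
  let ψ := (EuclideanSpace.equiv (Fin g) ℝ).toHomeomorph
  let E : EuclideanSpace ℝ (Fin g) → (Fin g → T) := E₀ ∘ ψ
  have hEo : IsOpenMap E := hE₀o.comp ψ.isOpenMap
  have hEa : ∀ θ i, E θ i = e (Circle.exp (θ i)) := fun _ _ => rfl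
  have hEc : Continuous E := by
    refine continuous_pi fun i => ?_
    simp only [hEa]
    fun_prop
  have hEs : Function.Surjective E :=
    (Function.Surjective.piMap fun _ => e.surjective.comp Circle.exp_surjective).comp ψ.surjective
  let S : Set (Fin g → T) := {t | ∃ i, ¬ IsCentral (t i : SU2)}
  have hSo : IsOpen S := by
    have : S = ⋃ i, {t | ¬ IsCentral (t i : SU2)} := by ext; simp [S]
    rw [this]
    refine isOpen_iUnion fun i => ?_
    have : IsClosed {t : Fin g → T | IsCentral (t i : SU2)} := by
      have hm : Continuous fun t : Fin g → T => mval (t i : SU2) :=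
        continuous_mval.comp (by fun_prop)
      exact (isClosed_eq hm continuous_const).union (isClosed_eq hm continuous_const)
    exact this.isOpen_compl
  let U : TopologicalSpace.Opens (EuclideanSpace ℝ (Fin g)) := ⟨E ⁻¹' S, hSo.preimage hEc⟩
  let F : U → {t : Fin g → T // ∃ i, ¬ IsCentral (t i : SU2)} := S.restrictPreimage E
  have hFo : IsOpenMap F := hEo.restrictPreimage S
  have hFc : Continuous F := hEc.restrictPreimage
  have hFs : Function.Surjective F := hEs.restrictPreimage S
  refine ⟨U, Quotient.mk (weylSetoid g T) ∘ F, localHomeo_of_open_locInj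
    (continuous_quotient_mk'.comp hFc) ((isOpenMap_weyl g).comp hFo) ?_,
    Quotient.mk_surjective.comp hFs⟩
  rintro ⟨θ, i, hi⟩
  rw [hEa, he, P.central] at hi
  -- neighbourhood where the coordinate avoids inversion
  have h1 : ∀ᶠ p : ℝ × ℝ in 𝓝 (θ i) ×ˢ 𝓝 (θ i), Circle.exp p.1 ≠ (Circle.exp p.2)⁻¹ := by
    rw [← nhds_prod_eq]
    refine ContinuousAt.eventually_ne (g := fun p : ℝ × ℝ => Circle.exp p.1 * Circle.exp p.2)
      (y := 1) (x := (θ i, θ i)) ?_ ?_ |>.mono ?_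
    · fun_prop
    · rwa [Ne, ← eq_inv_iff_mul_eq_one]
    · intro p hp
      rwa [Ne, eq_inv_iff_mul_eq_one]
  obtain ⟨A, hA, B, hB, hAB⟩ := Filter.mem_prod_iff.1 h1
  let N : Set (EuclideanSpace ℝ (Fin g)) :=
    {η | η i ∈ A ∩ B ∧ ∀ j, η j ∈ Metric.ball (θ j) 1}
  have hcoord : ∀ j, Continuous fun η : EuclideanSpace ℝ (Fin g) => η j := fun j => by fun_prop
  have hN : N ∈ 𝓝 θ := by
    apply Filter.inter_mem
    · exact (hcoord i).continuousAt (Filter.inter_mem hA hB)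
    · have : ∀ᶠ η in 𝓝 θ, ∀ j, η j ∈ Metric.ball (θ j) 1 := by
        rw [Filter.eventually_all]
        intro j
        exact (hcoord j).continuousAt (Metric.ball_mem_nhds _ one_pos)
      exact this
  refine ⟨Subtype.val ⁻¹' N, continuous_subtype_val.continuousAt hN, ?_⟩
  rintro ⟨η, hη⟩ ⟨hηi, hηj⟩ ⟨ζ, hζ⟩ ⟨hζi, hζj⟩ heq
  have heq' : weylSetoid g T (F ⟨η, hη⟩) (F ⟨ζ, hζ⟩) := Quotient.exact heq
  rcases heq' with h | h
  · have h' : ∀ j, Circle.exp (ζ j) = Circle.exp (η j) := fun j =>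
      e.injective (congrFun h j)
    apply Subtype.ext
    ext j
    have k1 := hηj j
    have k2 := hζj j
    simp only [Real.ball_eq_Ioo] at k1 k2
    refine (Circle.exp_injOn_of_forall_sub_mem_Ioo
      (s := Set.Ioo (θ j - 1) (θ j + 1)) ?_ k2 k1 (h' j)).symm
    intro x hx y hy
    have := Real.pi_gt_three
    constructor <;> linarith [hx.1, hx.2, hy.1, hy.2]
  · exfalso
    have h' : E ζ i = (E η i)⁻¹ := congrFun h i
    have h2 := congrArg Subtype.val h'
    rw [hEa, hEa, Subgroup.coe_inv, he, he, ← map_inv] at h2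
    exact hAB (show (ζ i, η i) ∈ A ×ˢ B from ⟨hζi.1, hηi.2⟩) (P.inj h2)

end TorusParam

/-- the stratum `L_H^1` of `SU(2)^g/SU(2)` of points with stabilizer a
maximal torus is homeomorphic to `T^{g*}/W`, the quotient of the non-central tuples in
`T^g` by the order-2 Weyl group acting by simultaneous inversion; in particular it is a
(topological) manifold of dimension `g`. -/
theorem stmt15 (g : ℕ) (T : Subgroup SU2) (hT : IsMaximalTorus T) :
    Nonempty (Quotient (weylSetoid g T) ≃ₜ stratum1 g T) ∧
    Nonempty (ChartedSpace (EuclideanSpace ℝ (Fin g)) (stratum1 g T)) := by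
  obtain ⟨P⟩ := exists_param hT
  obtain ⟨Φ⟩ := P.homeo g
  refine ⟨⟨Φ⟩, ?_⟩
  obtain ⟨U, G, hG, hs⟩ := P.exists_cover g
  exact charted_of_localHomeo U (Φ ∘ G) (Φ.isLocalHomeomorph.comp hG) (Φ.surjective.comp hs)
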